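/- arXiv:1609.02380 — 2 statements merged into one kernel-verified Lean document; each statement's English description precedes it below -/
import Mathlib

section
/- Let K be a 𝒫-component of a finite group G and let G₁, …, Gₙ be subnormal subgroups of G with K ≤ ⟨G₁, …, Gₙ⟩. Then K ≤ G_i for some i. -/
open Pointwise

namespace PaperPF
set_option linter.unusedVariables false

/-- A subgroup `K` is subnormal if there is a finite chain
`K = K₀ ⊴ K₁ ⊴ ⋯ ⊴ Kₙ = G` with each term normal in the next. -/
def IsSubnormal {G : Type} [Group G] (K : Subgroup G) : Prop :=
  ∃ (n : ℕ) (c : Fin (n + 1) → Subgroup G),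
    c 0 = K ∧ c (Fin.last n) = ⊤ ∧
      ∀ i : Fin n, c i.castSucc ≤ c i.succ ∧ ((c i.castSucc).subgroupOf (c i.succ)).Normal

/-- A finite group is quasisimple if it is perfect and its central quotient is a
nonabelian simple group. -/
def IsQuasisimple (X : Type) [Group X] : Prop :=
  commutator X = ⊤ ∧ IsSimpleGroup (X ⧸ Subgroup.center X) ∧
    ∃ a b : X ⧸ Subgroup.center X, a * b ≠ b * a

/-- A component: a quasisimple subnormal subgroup. -/
def IsComponent {G : Type} [Group G] (K : Subgroup G) : Prop :=
  IsSubnormal K ∧ IsQuasisimple ↥K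

/-- The subgroup generated by a family of subgroups. -/
def genBy {G : Type} [Group G] (S : Set (Subgroup G)) : Subgroup G :=
  Subgroup.closure (⋃ N ∈ S, (N : Set G))

theorem genBy_normal {G : Type} [Group G] {S : Set (Subgroup G)}
    (h : ∀ N ∈ S, N.Normal) : (genBy S).Normal := by
  constructor
  intro x hx g
  have hmap : Subgroup.map (MulAut.conj g).toMonoidHom (genBy S) ≤ genBy S := by
    rw [genBy, MonoidHom.map_closure]
    apply Subgroup.closure_mono
    rintro y ⟨z, hz, rfl⟩
    simp only [Set.mem_iUnion] at hz ⊢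
    obtain ⟨N, hN, hzN⟩ := hz
    exact ⟨N, hN, (h N hN).conj_mem z hzN g⟩
  exact hmap ⟨x, hx, rfl⟩

/-- `O_𝒫(G)`: the subgroup generated by all normal `𝒫`-subgroups. -/
def Op (P : (X : Type) → [inst : Group X] → Prop) (G : Type) [Group G] : Subgroup G :=
  genBy {N : Subgroup G | N.Normal ∧ P ↥N}

instance Op_normal (P : (X : Type) → [inst : Group X] → Prop) (G : Type) [Group G] :
    (Op P G).Normal :=
  genBy_normal fun _ hN => hN.1

/-- `N` is normal with `𝒫` quotient. -/
def QuotIsP (P : (X : Type) → [inst : Group X] → Prop) {G : Type} [Group G]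
    (N : Subgroup G) : Prop :=
  ∃ h : N.Normal, haveI := h; P (G ⧸ N)

/-- `O^𝒫(G)`: the intersection of all normal subgroups with `𝒫` quotient. -/
def Oup (P : (X : Type) → [inst : Group X] → Prop) (G : Type) [Group G] : Subgroup G :=
  ⨅ (N : Subgroup G) (_ : QuotIsP P N), N

/-- A `𝒫`-component. -/
def IsPComponent (P : (X : Type) → [inst : Group X] → Prop) {G : Type} [Group G]
    (K : Subgroup G) : Prop :=
  IsSubnormal K ∧ IsQuasisimple (↥K ⧸ Op P ↥K) ∧ Oup P ↥K = ⊤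

/-- The solvable radical. -/
def solRad (G : Type) [Group G] : Subgroup G :=
  genBy {N : Subgroup G | N.Normal ∧ IsSolvable ↥N}

/-- `O_{𝒫,E}(G) = O_𝒫(G) · L_𝒫(G)`. -/
def OPE (P : (X : Type) → [inst : Group X] → Prop) (G : Type) [Group G] : Subgroup G :=
  Op P G ⊔ sSup {K : Subgroup G | IsPComponent P K}



/-- The subgroup of points fixed by a single element `a`. -/
def fixedBySub {A : Type} (G : Type) [Monoid A] [Group G] [MulDistribMulAction A G]
    (a : A) : Subgroup G where
  carrier := {x : G | a • x = x}
  one_mem' := smul_one a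
  mul_mem' := fun {x y} hx hy => by
    show a • (x * y) = x * y
    rw [smul_mul', hx, hy]
  inv_mem' := fun {x} hx => by
    show a • x⁻¹ = x⁻¹
    rw [smul_inv', hx]

/-- The subgroup of points fixed by every element of a subgroup `B` of `A`. -/
def fixedOfSub {A : Type} (G : Type) [Group A] [Group G] [MulDistribMulAction A G]
    (B : Subgroup A) : Subgroup G where
  carrier := {x : G | ∀ b ∈ B, b • x = x}
  one_mem' := fun b _ => smul_one b
  mul_mem' := fun {x y} hx hy b hb => by rw [smul_mul', hx b hb, hy b hb]
  inv_mem' := fun {x} hx b hb => by rw [smul_inv', hx b hb]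

/-- The action of `A` restricted to an `A`-invariant subgroup. -/
def invSubAction (A : Type) {G : Type} [Monoid A] [Group G] [MulDistribMulAction A G]
    (K : Subgroup G) (hK : ∀ (a : A) (x : G), x ∈ K → a • x ∈ K) :
    MulDistribMulAction A ↥K where
  smul a x := ⟨a • (x : G), hK a x x.2⟩
  one_smul x := Subtype.ext (one_smul A (x : G))
  mul_smul a b x := Subtype.ext (mul_smul a b (x : G))
  smul_mul a x y := Subtype.ext (smul_mul' a (x : G) (y : G))
  smul_one a := Subtype.ext (smul_one a)

/-- The map induced by `a • ·` on the quotient by an `A`-invariant normal subgroup. -/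
def invQuotSMul (A : Type) {G : Type} [Monoid A] [Group G] [MulDistribMulAction A G]
    (N : Subgroup G) [N.Normal] (hN : ∀ (a : A) (x : G), x ∈ N → a • x ∈ N) (a : A) :
    G ⧸ N → G ⧸ N :=
  Quotient.map' (a • ·) (fun x y h => by
    rw [QuotientGroup.leftRel_apply] at h ⊢
    have := hN a _ h
    rwa [smul_mul', smul_inv'] at this)

theorem invQuotSMul_mk (A : Type) {G : Type} [Monoid A] [Group G] [MulDistribMulAction A G]
    (N : Subgroup G) [N.Normal] (hN : ∀ (a : A) (x : G), x ∈ N → a • x ∈ N) (a : A) (x : G) :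
    invQuotSMul A N hN a (x : G ⧸ N) = ((a • x : G) : G ⧸ N) := rfl

/-- The action of `A` induced on the quotient by an `A`-invariant normal subgroup. -/
def invQuotAction (A : Type) {G : Type} [Monoid A] [Group G] [MulDistribMulAction A G]
    (N : Subgroup G) [N.Normal] (hN : ∀ (a : A) (x : G), x ∈ N → a • x ∈ N) :
    MulDistribMulAction A (G ⧸ N) where
  smul := invQuotSMul A N hN
  one_smul q := QuotientGroup.induction_on q fun x => by
    show invQuotSMul A N hN 1 (x : G ⧸ N) = (x : G ⧸ N)
    rw [invQuotSMul_mk, one_smul]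
  mul_smul a b q := QuotientGroup.induction_on q fun x => by
    show invQuotSMul A N hN (a * b) (x : G ⧸ N)
        = invQuotSMul A N hN a (invQuotSMul A N hN b (x : G ⧸ N))
    rw [invQuotSMul_mk, invQuotSMul_mk, invQuotSMul_mk, mul_smul]
  smul_mul a q r := Quotient.inductionOn₂' q r fun x y => by
    show invQuotSMul A N hN a ((x : G ⧸ N) * (y : G ⧸ N))
        = invQuotSMul A N hN a (x : G ⧸ N) * invQuotSMul A N hN a (y : G ⧸ N)
    rw [← QuotientGroup.mk_mul, invQuotSMul_mk, invQuotSMul_mk, invQuotSMul_mk,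
      ← QuotientGroup.mk_mul, smul_mul']
  smul_one a := by
    show invQuotSMul A N hN a ((1 : G) : G ⧸ N) = ((1 : G) : G ⧸ N)
    rw [invQuotSMul_mk, smul_one]

/-- The action of `A` induced on the central quotient. -/
def centerQuotAction (A : Type) (X : Type) [Group A] [Group X] [MulDistribMulAction A X] :
    MulDistribMulAction A (X ⧸ Subgroup.center X) :=
  invQuotAction A (Subgroup.center X) (fun a x hx => by
    rw [Subgroup.mem_center_iff] at hx ⊢
    intro y
    calc y * a • x = a • (a⁻¹ • y * x) := by rw [smul_mul', smul_inv_smul]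
    _ = a • (x * a⁻¹ • y) := by rw [hx (a⁻¹ • y)]
    _ = a • x * y := by rw [smul_mul', smul_inv_smul])


/-- `X` is `A`-quasisimple: it is generated by its components, the set of components
is nonempty, and `A` permutes the components transitively. -/
def IsAQuasisimple (A X : Type) [Group A] [Group X] [MulDistribMulAction A X] : Prop :=
  {K : Subgroup X | IsComponent K}.Nonempty ∧
  sSup {K : Subgroup X | IsComponent K} = ⊤ ∧
  ∀ K L : Subgroup X, IsComponent K → IsComponent L → ∃ a : A, a • K = L

/-- An `A`-component: the subgroup generated by an orbit of `A` on the components. -/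
def IsAComponent (A : Type) {G : Type} [Group A] [Group G] [MulDistribMulAction A G]
    (K : Subgroup G) : Prop :=
  ∃ L : Subgroup G, IsComponent L ∧ K = ⨆ a : A, a • L

/-- An `(A,𝒫)`-component: an `A`-invariant subnormal subgroup `K` with
`K = O^𝒫(K)` and `K/O_𝒫(K)` `A`-quasisimple under the induced action. -/
def IsAPComponent (P : (X : Type) → [inst : Group X] → Prop) (A : Type) {G : Type}
    [Group A] [Group G] [MulDistribMulAction A G] (K : Subgroup G) : Prop :=
  IsSubnormal K ∧ Oup P ↥K = ⊤ ∧
  ∃ hK : ∀ (a : A) (x : G), x ∈ K → a • x ∈ K,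
    letI := invSubAction A K hK
    ∃ hOp : ∀ (a : A) (x : ↥K), x ∈ Op P ↥K → a • x ∈ Op P ↥K,
      letI := invQuotAction A (Op P ↥K) hOp
      IsAQuasisimple A (↥K ⧸ Op P ↥K)

/-- The commutator `[X, t]` of a subgroup with an element acting on `G`;
the subgroup generated by all `x⁻¹ * (t • x)`, `x ∈ X`. -/
def commSub {A : Type} {G : Type} [Monoid A] [Group G] [MulDistribMulAction A G]
    (t : A) (X : Subgroup G) : Subgroup G :=
  Subgroup.closure {y : G | ∃ x ∈ X, y = x⁻¹ * (t • x)}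


/-- `O_{n𝒫}(G)`: the subgroup generated by all `A`-invariant normal subgroups whose
fixed-point subgroup under `A` is a `𝒫`-group. -/
def OnP (P : (X : Type) → [inst : Group X] → Prop) (A : Type) (G : Type) [Monoid A] [Group G]
    [MulDistribMulAction A G] : Subgroup G :=
  genBy {N : Subgroup G | N.Normal ∧ (∀ (a : A) (x : G), x ∈ N → a • x ∈ N) ∧
    P ↥(N ⊓ FixedPoints.subgroup A G)}

/-- The group-theoretic property "is solvable". -/
def solP : (X : Type) → [inst : Group X] → Prop := fun X _ => IsSolvable X


section PerfectComonolithic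

open scoped commutatorElement

/-- Elementwise form of: `K` is perfect, and `Z` is a proper normal subgroup of `K` containing
every proper normal subgroup of `K`. -/
structure IsPerfectComonolithic {G : Type} [Group G] (K Z : Subgroup G) : Prop where
  perfect : K ≤ ⁅K, K⁆
  not_le : ¬ K ≤ Z
  le : Z ≤ K
  conj_mem : ∀ k ∈ K, ∀ z ∈ Z, k * z * k⁻¹ ∈ Z
  eq_or_le : ∀ N ≤ K, (∀ k ∈ K, ∀ a ∈ N, k * a * k⁻¹ ∈ N) → N = K ∨ N ≤ Z

theorem IsSubnormal.toMathlib {G : Type} [Group G] {K : Subgroup G} (h : IsSubnormal K) :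
    K.IsSubnormal := by
  obtain ⟨n, c, rfl, hn, hc⟩ := h
  refine Fin.reverseInduction (motive := fun i => (c i).IsSubnormal) ?_ (fun i ih => ?_) 0
  · rw [hn]; exact .top
  · exact .step _ _ (hc i).1 ih (hc i).2

namespace IsPerfectComonolithic

variable {G : Type} [Group G] {K Z : Subgroup G}

theorem exists_commutator_notMem (h : IsPerfectComonolithic K Z) :
    ∃ a ∈ K, ∃ b ∈ K, ⁅a, b⁆ ∉ Z := by
  by_contra! hcon
  exact h.not_le (h.perfect.trans (Subgroup.commutator_le.2 hcon))

/-- If `K` commutes modulo `Z` with its conjugate by an element of a subnormal subgroup `L`,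
then `K ≤ L`. -/
theorem le_of_commutator_conj_mem (h : IsPerfectComonolithic K Z) {L : Subgroup G}
    (hL : L.IsSubnormal) {x : G} (hx : x ∈ L)
    (hcomm : ∀ a ∈ K, ∀ b ∈ K, ⁅a, x * b * x⁻¹⁆ ∈ Z) : K ≤ L := by
  induction hL with
  | top => exact le_top
  | step L M hLM _ hN ih =>
    have hKM : K ≤ M := ih (hLM hx)
    have hconj := (Subgroup.normal_subgroupOf_iff hLM).1 hN
    rcases h.eq_or_le (L ⊓ K) inf_le_right (fun k hk a ha =>
      ⟨hconj a k ha.1 (hKM hk), K.mul_mem (K.mul_mem hk ha.2) (K.inv_mem hk)⟩) with heq | hle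
    · exact inf_eq_right.1 heq
    · exfalso
      obtain ⟨a, ha, b, hb, hab⟩ := h.exists_commutator_notMem
      have hm : b * ⁅a, x * b⁻¹ * x⁻¹⁆ * b⁻¹ ∈ Z :=
        h.conj_mem b hb _ (hcomm a ha b⁻¹ (K.inv_mem hb))
      have hu : b * (x * b⁻¹ * x⁻¹) ∈ L := by
        have := L.mul_mem (hconj x b hx (hKM hb)) (L.inv_mem hx)
        simpa only [mul_assoc] using this
      have hprod : ⁅a, b * (x * b⁻¹ * x⁻¹)⁆ = ⁅a, b⁆ * (b * ⁅a, x * b⁻¹ * x⁻¹⁆ * b⁻¹) := by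
        simp only [commutatorElement_def]; group
      have hL' : ⁅a, b * (x * b⁻¹ * x⁻¹)⁆ ∈ L := by
        rw [commutatorElement_def]
        exact L.mul_mem (hconj _ a hu (hKM ha)) (L.inv_mem hu)
      have hK' : ⁅a, b * (x * b⁻¹ * x⁻¹)⁆ ∈ K := by
        rw [hprod]
        refine K.mul_mem ?_ (h.le hm)
        exact K.mul_mem (K.mul_mem (K.mul_mem ha hb) (K.inv_mem ha)) (K.inv_mem hb)
      have hZ := hle ⟨hL', hK'⟩
      rw [hprod] at hZ
      exact hab ((Z.mul_mem_cancel_right hm).1 hZ)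

/-- Wielandt: a subnormal subgroup either contains a subnormal perfect comonolithic subgroup
or normalizes it. -/
theorem le_or_normalizes [Finite G] (h : IsPerfectComonolithic K Z) (hK : IsSubnormal K)
    {L : Subgroup G} (hL : L.IsSubnormal) : K ≤ L ∨ ∀ x ∈ L, ∀ k ∈ K, x * k * x⁻¹ ∈ K := by
  obtain ⟨n, c, hc0, hn, hc⟩ := hK
  have key : ∀ i, K ≤ c i ∧ ∀ L : Subgroup G, L.IsSubnormal → L ≤ c i →
      K ≤ L ∨ ∀ x ∈ L, ∀ k ∈ K, x * k * x⁻¹ ∈ K := by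
    intro i
    induction i using Fin.induction with
    | zero =>
      refine ⟨hc0.ge, fun L _ hLc => .inr fun x hx k hk => ?_⟩
      have hxK : x ∈ K := hc0 ▸ hLc hx
      exact K.mul_mem (K.mul_mem hxK hk) (K.inv_mem hxK)
    | succ i ih =>
      obtain ⟨hKc, ih⟩ := ih
      refine ⟨hKc.trans (hc i).1, fun L hL hLc => ?_⟩
      by_contra! hcon
      obtain ⟨hKL, x, hx, k, hk, hxk⟩ := hcon
      have hKs : K.IsSubnormal := IsSubnormal.toMathlib ⟨n, c, hc0, hn, hc⟩
      have hconj := (Subgroup.normal_subgroupOf_iff (hc i).1).1 (hc i).2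
      have hmem : ∀ (y a : G), a ∈ K → y * a * y⁻¹ ∈ MulAut.conj y • K := fun y a ha =>
        Subgroup.smul_mem_pointwise_smul a (MulAut.conj y) K ha
      have hmem' : ∀ (y a : G), a ∈ MulAut.conj y • K → ∃ b ∈ K, y * b * y⁻¹ = a := by
        intro y a ha
        obtain ⟨b, hb, rfl⟩ := ha
        exact ⟨b, hb, rfl⟩
      have hne : ∀ y : G, K ≤ MulAut.conj y • K → K = MulAut.conj y • K := fun y hy =>
        Subgroup.eq_of_le_of_card_ge hy
          (Nat.card_congr (Subgroup.equivSMul (MulAut.conj y) K).toEquiv).ge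
      have hnorm : ∀ y ∈ c i.succ, ∀ a ∈ K, ∀ b ∈ K,
          (y * a * y⁻¹) * b * (y * a * y⁻¹)⁻¹ ∈ K := by
        intro y hy a ha b hb
        have hle : MulAut.conj y • K ≤ c i.castSucc := by
          intro z hz
          obtain ⟨d, hd, rfl⟩ := hmem' y z hz
          exact hconj d y (hKc hd) hy
        rcases ih _ (hKs.smul (MulAut.conj y)) hle with h1 | h1
        · have hyK : y * a * y⁻¹ ∈ K := by rw [hne y h1]; exact hmem y a ha
          exact K.mul_mem (K.mul_mem hyK hb) (K.inv_mem hyK)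
        · exact h1 _ (hmem y a ha) b hb
      have hnorm' : ∀ a ∈ K, ∀ b ∈ K, a * (x * b * x⁻¹) * a⁻¹ ∈ MulAut.conj x • K := by
        intro a ha b hb
        have := hmem x _ (hnorm x⁻¹ (inv_mem (hLc hx)) a ha b hb)
        convert this using 1
        group
      rcases h.eq_or_le (K ⊓ MulAut.conj x • K) inf_le_left (fun a ha d hd => by
          obtain ⟨b, hb, hbd⟩ := hmem' x d hd.2
          exact ⟨K.mul_mem (K.mul_mem ha hd.1) (K.inv_mem ha), hbd ▸ hnorm' a ha b hb⟩)
        with heq | hle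
      · apply hxk
        rw [hne x (inf_eq_left.1 heq)]
        exact hmem x k hk
      · refine hKL (h.le_of_commutator_conj_mem hL hx fun a ha b hb =>
          hle (Subgroup.mem_inf.2 ⟨?_, ?_⟩))
        · have := K.mul_mem ha (hnorm x (hLc hx) b hb a⁻¹ (K.inv_mem ha))
          simpa only [commutatorElement_def, mul_assoc] using this
        · exact mul_mem (hnorm' a ha b hb) (inv_mem (hmem x b hb))
  exact (key (Fin.last n)).2 L hL (hn ▸ le_top)

/-- If a subnormal subgroup `L` normalizes `K` and does not contain `K`, then it centralizes
`K` modulo `Z`. -/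
theorem commutator_le_of_not_le (h : IsPerfectComonolithic K Z) {L : Subgroup G}
    (hL : L.IsSubnormal) (hnorm : ∀ x ∈ L, ∀ k ∈ K, x * k * x⁻¹ ∈ K) (hKL : ¬ K ≤ L) :
    ⁅K, L⁆ ≤ Z := by
  have hle : ⁅K, L⁆ ≤ K := Subgroup.commutator_le.2 fun k hk x hx => by
    have := K.mul_mem hk (hnorm x hx k⁻¹ (K.inv_mem hk))
    simpa only [commutatorElement_def, mul_assoc] using this
  have hconj : ∀ k ∈ K, ∀ a ∈ ⁅K, L⁆, k * a * k⁻¹ ∈ ⁅K, L⁆ := by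
    intro k hk a ha
    induction ha using Subgroup.closure_induction with
    | mem a ha =>
      obtain ⟨b, hb, x, hx, rfl⟩ := ha
      have : k * ⁅b, x⁆ * k⁻¹ = ⁅k * b, x⁆ * ⁅k, x⁆⁻¹ := by
        simp only [commutatorElement_def]; group
      rw [this]
      exact mul_mem (Subgroup.commutator_mem_commutator (mul_mem hk hb) hx)
        (inv_mem (Subgroup.commutator_mem_commutator hk hx))
    | one => simp
    | mul a b _ _ iha ihb => simpa [mul_assoc] using mul_mem iha ihb
    | inv a _ iha => simpa [mul_assoc] using inv_mem iha
  refine (h.eq_or_le _ hle hconj).resolve_left fun heq => hKL ?_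
  clear hKL hnorm hle hconj
  have main : ∀ M : Subgroup G, M.IsSubnormal → L ≤ M → K ≤ M := by
    intro M hM
    induction hM with
    | top => exact fun _ => le_top
    | step M N hMN _ hN ih =>
      intro hLM
      have hKN := ih (hLM.trans hMN)
      rw [← heq]
      refine Subgroup.commutator_le.2 fun k hk x hx => ?_
      rw [commutatorElement_def]
      exact mul_mem ((Subgroup.normal_subgroupOf_iff hMN).1 hN _ _ (hLM hx) (hKN hk))
        (inv_mem (hLM hx))
  exact main L hL le_rfl

theorem conj_mem_of_normalizes (h : IsPerfectComonolithic K Z) {x : G}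
    (hx : ∀ k ∈ K, x * k * x⁻¹ ∈ K) (hx' : ∀ k ∈ K, x⁻¹ * k * x ∈ K) {z : G} (hz : z ∈ Z) :
    x * z * x⁻¹ ∈ Z := by
  have hmem : x * z * x⁻¹ ∈ Z.map (MulAut.conj x).toMonoidHom := ⟨z, hz, rfl⟩
  have hle : Z.map (MulAut.conj x).toMonoidHom ≤ K := by
    rintro _ ⟨w, hw, rfl⟩
    exact hx w (h.le hw)
  have hconj : ∀ k ∈ K, ∀ a ∈ Z.map (MulAut.conj x).toMonoidHom,
      k * a * k⁻¹ ∈ Z.map (MulAut.conj x).toMonoidHom := by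
    rintro k hk _ ⟨w, hw, rfl⟩
    refine ⟨_, h.conj_mem _ (hx' k hk) w hw, ?_⟩
    simp [mul_assoc]
  refine (h.eq_or_le _ hle hconj).resolve_left (fun heq => h.not_le fun k hk => ?_) hmem
  have hxk := hx k hk
  rw [← heq] at hxk
  obtain ⟨w, hw, hwk⟩ := hxk
  have : w = k := by simpa using hwk
  exact this ▸ hw

theorem exists_le_of_le_iSup [Finite G] (h : IsPerfectComonolithic K Z) (hK : IsSubnormal K)
    {ι : Type*} {L : ι → Subgroup G} (hL : ∀ i, (L i).IsSubnormal) (hle : K ≤ ⨆ i, L i) :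
    ∃ i, K ≤ L i := by
  by_contra! hcon
  have hnorm i := (h.le_or_normalizes hK (hL i)).resolve_left (hcon i)
  have hcomm i := h.commutator_le_of_not_le (hL i) (hnorm i) (hcon i)
  have key : ∀ x ∈ ⨆ i, L i, (∀ k ∈ K, x * k * x⁻¹ ∈ K) ∧ (∀ k ∈ K, x⁻¹ * k * x ∈ K) ∧
      ∀ k ∈ K, ⁅k, x⁆ ∈ Z := by
    intro x hx
    induction hx using Subgroup.iSup_induction' with
    | hp i x hx =>
      exact ⟨hnorm i x hx, fun k hk => by simpa using hnorm i x⁻¹ (inv_mem hx) k hk,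
        fun k hk => hcomm i (Subgroup.commutator_mem_commutator hk hx)⟩
    | h1 => simp [Z.one_mem]
    | hmul x y _ _ ihx ihy =>
      refine ⟨fun k hk => ?_, fun k hk => ?_, fun k hk => ?_⟩
      · simpa [mul_assoc] using ihx.1 _ (ihy.1 k hk)
      · simpa [mul_assoc] using ihy.2.1 _ (ihx.2.1 k hk)
      · have : ⁅k, x * y⁆ = ⁅k, x⁆ * (x * ⁅k, y⁆ * x⁻¹) := by
          simp only [commutatorElement_def]; group
        rw [this]
        exact mul_mem (ihx.2.2 k hk) (h.conj_mem_of_normalizes ihx.1 ihx.2.1 (ihy.2.2 k hk))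
  obtain ⟨a, ha, b, hb, hab⟩ := h.exists_commutator_notMem
  exact hab ((key b (hle hb)).2.2 a ha)

end IsPerfectComonolithic

/-- A subgroup with a largest proper normal subgroup, from data on its underlying group. -/
theorem isPerfectComonolithic_map_subtype {G : Type} [Group G] {K : Subgroup G}
    (hperf : commutator ↥K = ⊤) (Z : Subgroup ↥K) [Z.Normal] (hZ : Z ≠ ⊤)
    (hmax : ∀ N : Subgroup ↥K, N.Normal → N = ⊤ ∨ N ≤ Z) :
    IsPerfectComonolithic K (Z.map K.subtype) where
  perfect := by
    have h := congrArg (Subgroup.map K.subtype) hperf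
    rw [commutator_def, Subgroup.map_commutator, ← MonoidHom.range_eq_map, K.range_subtype] at h
    exact h.ge
  not_le hle := hZ <| by
    refine (Subgroup.eq_top_iff' _).2 fun x => ?_
    obtain ⟨y, hy, hyx⟩ := hle x.2
    exact (Subtype.ext hyx : y = x) ▸ hy
  le := Subgroup.map_subtype_le Z
  conj_mem := by
    rintro k hk _ ⟨z, hz, rfl⟩
    exact ⟨⟨k, hk⟩ * z * ⟨k, hk⟩⁻¹, ‹Z.Normal›.conj_mem z hz _, rfl⟩
  eq_or_le N hN hconj := by
    rcases hmax (N.subgroupOf K) ⟨fun a ha k => hconj k k.2 a ha⟩ with h | h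
    · exact .inl (hN.antisymm (Subgroup.subgroupOf_eq_top.1 h))
    · exact .inr fun x hx => ⟨⟨x, hN hx⟩, h hx, rfl⟩

/-- A normal subgroup of a quasisimple group is either central or the whole group. -/
theorem IsQuasisimple.eq_top_or_le_center {Q : Type} [Group Q] (hQ : IsQuasisimple Q)
    (N : Subgroup Q) (hN : N.Normal) : N = ⊤ ∨ N ≤ Subgroup.center Q := by
  obtain ⟨hperf, hsimple, -⟩ := hQ
  have hmap : (N.map (QuotientGroup.mk' (Subgroup.center Q))).Normal :=
    hN.map _ (QuotientGroup.mk'_surjective _)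
  rcases hsimple.eq_bot_or_eq_top_of_normal _ hmap with h | h
  · right
    rw [Subgroup.map_eq_bot_iff, QuotientGroup.ker_mk'] at h
    exact h
  · left
    have hdecomp : ∀ q : Q, ∃ n ∈ N, ∃ z ∈ Subgroup.center Q, q = n * z := by
      intro q
      obtain ⟨n, hn, hnq⟩ := h.ge (Subgroup.mem_top (QuotientGroup.mk' _ q))
      exact ⟨n, hn, n⁻¹ * q, QuotientGroup.eq.1 hnq, by group⟩
    rw [eq_top_iff, ← hperf, commutator_def]
    refine Subgroup.commutator_le.2 fun a _ b _ => ?_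
    obtain ⟨n, hn, z, hz, rfl⟩ := hdecomp a
    have hz' := Subgroup.mem_center_iff.1 hz
    have : ⁅n * z, b⁆ = n * (b * n⁻¹ * b⁻¹) := by
      rw [commutatorElement_def, mul_inv_rev, mul_assoc n z b, ← hz' b]
      group
    rw [this]
    exact mul_mem hn (hN.conj_mem _ (inv_mem hn) b)

theorem IsQuasisimple.center_ne_top {Q : Type} [Group Q] (hQ : IsQuasisimple Q) :
    Subgroup.center Q ≠ ⊤ := by
  obtain ⟨-, -, a, b, hab⟩ := hQ
  intro h
  have := QuotientGroup.subsingleton_quotient_top (G := Q)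
  rw [← h] at this
  exact hab (Subsingleton.elim _ _)

/-- `O_𝒫(X)` is trivial or is itself a `𝒫`-group. -/
theorem Op_eq_bot_or_prop (P : (X : Type) → [inst : Group X] → Prop)
    (hJoinClosed : ∀ (X : Type) [Group X] [Finite X] (M N : Subgroup X) [M.Normal] [N.Normal],
      P ↥M → P ↥N → P ↥(M ⊔ N))
    (X : Type) [Group X] [Finite X] : Op P X = ⊥ ∨ P ↥(Op P X) := by
  rcases Set.eq_empty_or_nonempty {N : Subgroup X | N.Normal ∧ P ↥N} with hS | hS
  · left
    simp [Op, genBy, hS]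
  · right
    obtain ⟨M, ⟨hM, hPM⟩, hmax⟩ := (Set.toFinite _).exists_maximal hS
    have : Op P X = M := by
      apply le_antisymm
      · refine (Subgroup.closure_le _).2 (Set.iUnion₂_subset fun N hN => ?_)
        have := hN.1
        exact SetLike.coe_subset_coe.2 <| le_sup_right.trans
          (hmax ⟨Subgroup.sup_normal M N, hJoinClosed X M N hPM hN.2⟩ le_sup_left)
      · intro x hx
        exact Subgroup.subset_closure (Set.mem_biUnion (⟨hM, hPM⟩ : _ ∧ _) hx)
    rwa [this]

/-- A normal supplement of `O_𝒫(X)` is everything if `X = O^𝒫(X)`. -/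
theorem eq_top_of_sup_Op_eq_top (P : (X : Type) → [inst : Group X] → Prop)
    (hIso : ∀ (X Y : Type) [Group X] [Group Y] [Finite X], Nonempty (X ≃* Y) → P X → P Y)
    (hQuotClosed : ∀ (X : Type) [Group X] [Finite X], P X →
      ∀ (N : Subgroup X) [N.Normal], P (X ⧸ N))
    (hJoinClosed : ∀ (X : Type) [Group X] [Finite X] (M N : Subgroup X) [M.Normal] [N.Normal],
      P ↥M → P ↥N → P ↥(M ⊔ N))
    (X : Type) [Group X] [Finite X] (hX : Oup P X = ⊤) (N : Subgroup X) [N.Normal]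
    (hN : N ⊔ Op P X = ⊤) : N = ⊤ := by
  rcases Op_eq_bot_or_prop P hJoinClosed X with hO | hO
  · simpa [hO] using hN
  · have hsurj : Function.Surjective ((QuotientGroup.mk' N).comp (Op P X).subtype) := by
      rw [← MonoidHom.range_eq_top, MonoidHom.range_comp, Subgroup.range_subtype]
      have h := congrArg (Subgroup.map (QuotientGroup.mk' N)) hN
      rwa [Subgroup.map_sup, QuotientGroup.map_mk'_self, bot_sup_eq,
        Subgroup.map_top_of_surjective _ (QuotientGroup.mk'_surjective N)] at h
    have hP : P (X ⧸ N) := hIso _ _ ⟨QuotientGroup.quotientKerEquivOfSurjective _ hsurj⟩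
      (hQuotClosed _ hO _)
    rw [eq_top_iff, ← hX]
    exact iInf₂_le N ⟨inferInstance, hP⟩

theorem IsPComponent.exists_isPerfectComonolithic (P : (X : Type) → [inst : Group X] → Prop)
    (hIso : ∀ (X Y : Type) [Group X] [Group Y] [Finite X], Nonempty (X ≃* Y) → P X → P Y)
    (hQuotClosed : ∀ (X : Type) [Group X] [Finite X], P X →
      ∀ (N : Subgroup X) [N.Normal], P (X ⧸ N))
    (hJoinClosed : ∀ (X : Type) [Group X] [Finite X] (M N : Subgroup X) [M.Normal] [N.Normal],
      P ↥M → P ↥N → P ↥(M ⊔ N))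
    {G : Type} [Group G] [Finite G] {K : Subgroup G} (hK : IsPComponent P K) :
    ∃ Z, IsPerfectComonolithic K Z := by
  obtain ⟨-, hQ, hOup⟩ := hK
  have hsurj := QuotientGroup.mk'_surjective (Op P ↥K)
  have htop : ∀ N : Subgroup ↥K, N.Normal → N.map (QuotientGroup.mk' (Op P ↥K)) = ⊤ → N = ⊤ := by
    intro N _ h
    refine eq_top_of_sup_Op_eq_top P hIso hQuotClosed hJoinClosed ↥K hOup N ?_
    have := congrArg (Subgroup.comap (QuotientGroup.mk' (Op P ↥K))) h
    rwa [Subgroup.comap_map_eq, QuotientGroup.ker_mk', Subgroup.comap_top] at this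
  refine ⟨_, isPerfectComonolithic_map_subtype (htop _ inferInstance ?_)
    ((Subgroup.center (↥K ⧸ Op P ↥K)).comap (QuotientGroup.mk' _)) (fun h => ?_)
    fun N hN => ?_⟩
  · rw [commutator_def, Subgroup.map_commutator, Subgroup.map_top_of_surjective _ hsurj]
    exact hQ.1
  · apply hQ.center_ne_top
    rw [← Subgroup.map_comap_eq_self_of_surjective hsurj (Subgroup.center _), h,
      Subgroup.map_top_of_surjective _ hsurj]
  · rcases hQ.eq_top_or_le_center _ (hN.map _ hsurj) with h | h
    · exact .inl (htop N hN h)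
    · exact .inr (Subgroup.map_le_iff_le_comap.1 h)

end PerfectComonolithic

theorem statement_6
    (P : (X : Type) → [inst : Group X] → Prop)
    (hIso : ∀ (X Y : Type) [Group X] [Group Y] [Finite X], Nonempty (X ≃* Y) → P X → P Y)
    (hSubClosed : ∀ (X : Type) [Group X] [Finite X], P X → ∀ H : Subgroup X, P ↥H)
    (hQuotClosed : ∀ (X : Type) [Group X] [Finite X], P X → ∀ (N : Subgroup X) [N.Normal], P (X ⧸ N))
    (hInfClosed : ∀ (X : Type) [Group X] [Finite X] (M N : Subgroup X) [M.Normal] [N.Normal],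
      P (X ⧸ M) → P (X ⧸ N) → P (X ⧸ (M ⊓ N)))
    (hJoinClosed : ∀ (X : Type) [Group X] [Finite X] (M N : Subgroup X) [M.Normal] [N.Normal],
      P ↥M → P ↥N → P ↥(M ⊔ N))
    (G : Type) [Group G] [Finite G] (K : Subgroup G) (hK : IsPComponent P K)
    (n : ℕ) (Gs : Fin n → Subgroup G) (hGs : ∀ i, IsSubnormal (Gs i))
    (hle : K ≤ ⨆ i, Gs i) :
    ∃ i, K ≤ Gs i := by
  obtain ⟨Z, hZ⟩ := hK.exists_isPerfectComonolithic P hIso hQuotClosed hJoinClosed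
  exact hZ.exists_le_of_le_iSup hK.1 (fun i => (hGs i).toMathlib) hle

end PaperPF
end

section
/- Let G be a finite group and let 𝒞 and 𝒟 be sets of 𝒫-components of G such that the subgroup generated by the members of 𝒞 equals the subgroup generated by the members of 𝒟. Then 𝒞 = 𝒟. -/
open Pointwise

namespace PaperPF
set_option linter.unusedVariables false

section QuasisimpleSubgroups

open Subgroup

theorem IsSubnormal.toSubgroup {G : Type} [Group G] {K : Subgroup G} (hK : IsSubnormal K) :
    K.IsSubnormal := by
  obtain ⟨n, c, rfl, htop, hstep⟩ := hK
  have key : ∀ i : Fin (n + 1), (c i).IsSubnormal := by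
    intro i
    induction i using Fin.reverseInduction with
    | last => rw [htop]; exact Subgroup.IsSubnormal.top
    | cast i ih => exact Subgroup.IsSubnormal.step _ _ (hstep i).1 ih (hstep i).2
  exact key 0

/-- A normal subgroup of a quasisimple group is the whole group or central. -/
theorem IsQuasisimple.eq_top_or_le_center_s7 {X : Type} [Group X] (hX : IsQuasisimple X)
    (M : Subgroup X) [M.Normal] : M = ⊤ ∨ M ≤ center X := by
  obtain ⟨hperf, hsimple, -⟩ := hX
  have hnormal : (M.map (QuotientGroup.mk' (center X))).Normal :=
    Subgroup.Normal.map inferInstance _ (QuotientGroup.mk'_surjective _)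
  rcases hnormal.eq_bot_or_eq_top with h | h
  · right
    rwa [Subgroup.map_eq_bot_iff, QuotientGroup.ker_mk'] at h
  · left
    have hsup : M ⊔ center X = ⊤ := by
      have := congrArg (Subgroup.comap (QuotientGroup.mk' (center X))) h
      rwa [Subgroup.comap_map_eq, QuotientGroup.ker_mk', Subgroup.comap_top] at this
    rw [eq_top_iff, ← hperf]
    exact Subgroup.Normal.commutator_le_of_self_sup_commutative_eq_top hsup inferInstance

theorem IsQuasisimple.nontrivial {X : Type} [Group X] (hX : IsQuasisimple X) : Nontrivial X := by
  obtain ⟨-, -, a, b, hab⟩ := hX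
  by_contra hcon
  rw [not_nontrivial_iff_subsingleton] at hcon
  exact hab (Subsingleton.elim _ _)

/-- A nontrivial perfect subgroup `A` such that every subgroup it normalizes either contains it
or meets it in a central subgroup; this holds for quasisimple subgroups. -/
structure IsQuasisimpleSubgroup {G : Type} [Group G] (A : Subgroup G) : Prop where
  perfect : ⁅A, A⁆ = A
  ne_bot : A ≠ ⊥
  le_or_central : ∀ S : Subgroup G, A ≤ normalizer (S : Set G) → A ≤ S ∨ ⁅S ⊓ A, A⁆ = ⊥

theorem IsQuasisimple.range {X G : Type} [Group X] [Group G] (hX : IsQuasisimple X)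
    {f : X →* G} (hf : Function.Injective f) : IsQuasisimpleSubgroup f.range := by
  refine ⟨?_, ?_, ?_⟩
  · rw [MonoidHom.range_eq_map, ← map_commutator, ← _root_.commutator_def, hX.1]
  · intro h
    have := hX.nontrivial
    obtain ⟨x, hx⟩ := exists_ne (1 : X)
    have hmem : f x ∈ f.range := ⟨x, rfl⟩
    rw [h, mem_bot] at hmem
    exact hx (hf (hmem.trans f.map_one.symm))
  · intro S hS
    have hnormal : (S.comap f).Normal := by
      refine ⟨fun s hs x => ?_⟩
      have := (mem_normalizer_iff.mp (hS ⟨x, rfl⟩) (f s)).mp hs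
      simpa using this
    rcases hX.eq_top_or_le_center_s7 (S.comap f) with h | h
    · left
      rintro _ ⟨x, rfl⟩
      have hx : x ∈ S.comap f := h ▸ mem_top x
      exact hx
    · right
      rw [commutator_eq_bot_iff_le_centralizer]
      rintro _ ⟨hs, x, rfl⟩
      rw [mem_centralizer_iff]
      rintro _ ⟨y, rfl⟩
      rw [← map_mul, ← map_mul, mem_center_iff.mp (h hs) y]

/-- Centralization by a perfect subgroup `A` propagates up a subnormal chain above `A`. -/
theorem commutator_eq_bot_of_subnormal {G : Type} [Group G] {A Y H : Subgroup G}
    (hperf : ⁅A, A⁆ = A) (hY : A ≤ normalizer (Y : Set G)) (hH : H.IsSubnormal) (hAH : A ≤ H)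
    (h : ⁅Y ⊓ H, A⁆ = ⊥) : ⁅Y, A⁆ = ⊥ := by
  induction hH with
  | top => simpa using h
  | step H K hHK _ hnormal ih =>
    refine ih (hAH.trans hHK) ?_
    have hKH : K ≤ normalizer (H : Set G) := (normal_subgroupOf_iff_le_normalizer hHK).mp hnormal
    have hle : ⁅Y ⊓ K, A⁆ ≤ Y ⊓ H := by
      refine le_inf ?_ ?_
      · exact (commutator_mono inf_le_left le_rfl).trans
          (le_normalizer_iff_commutator_le_left.mp hY)
      · exact (commutator_mono inf_le_right hAH).trans
          (le_normalizer_iff_commutator_le_right.mp hKH)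
    have h1 : ⁅⁅Y ⊓ K, A⁆, A⁆ = ⊥ := by
      rw [eq_bot_iff, ← h]
      exact commutator_mono hle le_rfl
    have h2 : ⁅⁅A, A⁆, Y ⊓ K⁆ = ⊥ :=
      commutator_commutator_eq_bot_of_rotate (by rw [commutator_comm A (Y ⊓ K)]; exact h1) h1
    rwa [hperf, commutator_comm] at h2

/-- A subnormal quasisimple subgroup is contained in or centralizes each subnormal subgroup. -/
theorem IsQuasisimpleSubgroup.le_or_commutator_eq_bot {G : Type} [Group G] {A S : Subgroup G}
    (hA : IsQuasisimpleSubgroup A) (hsub : A.IsSubnormal) (hS : S.IsSubnormal) :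
    A ≤ S ∨ ⁅S, A⁆ = ⊥ := by
  induction hS with
  | top => exact Or.inl le_top
  | step S K hSK _ hnormal ih =>
    rcases ih with h | h
    · have hn : A ≤ normalizer (S : Set G) :=
        h.trans ((normal_subgroupOf_iff_le_normalizer hSK).mp hnormal)
      exact (hA.le_or_central S hn).imp_right
        (commutator_eq_bot_of_subnormal hA.perfect hn hsub le_rfl)
    · right
      rw [eq_bot_iff, ← h]
      exact commutator_mono hSK le_rfl

/-- Distinct subnormal quasisimple subgroups commute. -/
theorem IsQuasisimpleSubgroup.eq_or_commutator_eq_bot {G : Type} [Group G] {A B : Subgroup G}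
    (hA : IsQuasisimpleSubgroup A) (hB : IsQuasisimpleSubgroup B)
    (hAs : A.IsSubnormal) (hBs : B.IsSubnormal) : A = B ∨ ⁅A, B⁆ = ⊥ := by
  rcases hA.le_or_commutator_eq_bot hAs hBs with h | h
  · exact (hB.le_or_commutator_eq_bot hBs hAs).imp_left (le_antisymm h)
  · exact Or.inr (by rw [commutator_comm]; exact h)

end QuasisimpleSubgroups

section Radical

variable {P : (X : Type) → [inst : Group X] → Prop}

theorem le_Op {X : Type} [Group X] {N : Subgroup X} (hN : N.Normal) (hP : P ↥N) :
    N ≤ Op P X := fun x hx =>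
  Subgroup.subset_closure (Set.mem_iUnion₂.mpr ⟨N, ⟨hN, hP⟩, hx⟩)

theorem Op_le {X : Type} [Group X] {H : Subgroup X}
    (h : ∀ N : Subgroup X, N.Normal → P ↥N → N ≤ H) : Op P X ≤ H :=
  (Subgroup.closure_le H).mpr (Set.iUnion₂_subset fun N hN => h N hN.1 hN.2)

theorem Op_eq_bot_or
    (hJoinClosed : ∀ (X : Type) [Group X] [Finite X] (M N : Subgroup X) [M.Normal] [N.Normal],
      P ↥M → P ↥N → P ↥(M ⊔ N))
    (X : Type) [Group X] [Finite X] : Op P X = ⊥ ∨ P ↥(Op P X) := by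
  by_cases hne : {N : Subgroup X | N.Normal ∧ P ↥N}.Nonempty
  · right
    obtain ⟨M, hM⟩ := (Set.toFinite {N : Subgroup X | N.Normal ∧ P ↥N}).exists_maximal hne
    have hMn : M.Normal := hM.prop.1
    have hMP : P ↥M := hM.prop.2
    have heq : Op P X = M := by
      refine le_antisymm (Op_le fun N hN hNP => ?_) (le_Op hMn hMP)
      exact le_sup_right.trans (hM.le_of_ge
        ⟨Subgroup.sup_normal M N, hJoinClosed X M N hMP hNP⟩ le_sup_left)
    rw [heq]
    exact hMP
  · left
    exact le_bot_iff.mp (Op_le fun N hN hNP => (hne ⟨N, hN, hNP⟩).elim)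

variable
    (hIso : ∀ (X Y : Type) [Group X] [Group Y] [Finite X], Nonempty (X ≃* Y) → P X → P Y)

include hIso

theorem map_Op_le {X Y : Type} [Group X] [Group Y] [Finite X] (e : X ≃* Y) :
    (Op P X).map e.toMonoidHom ≤ Op P Y := by
  rw [Subgroup.map_le_iff_le_comap]
  refine Op_le fun N hN hNP => Subgroup.map_le_iff_le_comap.mp ?_
  exact le_Op (hN.map _ e.surjective) (hIso _ _ ⟨e.subgroupMap N⟩ hNP)

theorem Op_characteristic (X : Type) [Group X] [Finite X] : (Op P X).Characteristic :=
  Subgroup.characteristic_iff_map_le.mpr fun e => map_Op_le hIso e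

variable
    (hJoinClosed : ∀ (X : Type) [Group X] [Finite X] (M N : Subgroup X) [M.Normal] [N.Normal],
      P ↥M → P ↥N → P ↥(M ⊔ N))

include hJoinClosed

theorem map_subtype_Op_le_of_normal {X : Type} [Group X] [Finite X] (H : Subgroup X) [H.Normal] :
    (Op P ↥H).map H.subtype ≤ Op P X := by
  have := Op_characteristic hIso ↥H
  rcases Op_eq_bot_or hJoinClosed ↥H with h | h
  · rw [h, Subgroup.map_bot]
    exact bot_le
  · exact le_Op inferInstance
      (hIso _ _ ⟨(Op P ↥H).equivMapOfInjective _ H.subtype_injective⟩ h)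

theorem map_subtype_Op_le {G : Type} [Group G] [Finite G] {H : Subgroup G}
    (hH : H.IsSubnormal) : (Op P ↥H).map H.subtype ≤ Op P G := by
  induction hH with
  | top => exact map_subtype_Op_le_of_normal hIso hJoinClosed ⊤
  | step H K hHK _ hnormal ih =>
    rintro _ ⟨x, hx, rfl⟩
    have h1 := map_Op_le hIso (Subgroup.subgroupOfEquivOfLe hHK).symm ⟨x, hx, rfl⟩
    have h2 := map_subtype_Op_le_of_normal hIso hJoinClosed (H.subgroupOf K) ⟨_, h1, rfl⟩
    exact ih ⟨_, h2, rfl⟩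

variable
    (hSubClosed : ∀ (X : Type) [Group X] [Finite X], P X → ∀ H : Subgroup X, P ↥H)

include hSubClosed

theorem Op_eq_subgroupOf {G : Type} [Group G] [Finite G] {H : Subgroup G}
    (hH : H.IsSubnormal) : Op P ↥H = (Op P G).subgroupOf H := by
  apply le_antisymm
  · exact Subgroup.map_le_iff_le_comap.mp (map_subtype_Op_le hIso hJoinClosed hH)
  · rcases Op_eq_bot_or hJoinClosed G with h | h
    · rw [h, Subgroup.bot_subgroupOf]
      exact bot_le
    · refine le_Op inferInstance (hIso _ _ ⟨?_⟩ (hSubClosed _ h (H.subgroupOf (Op P G))))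
      exact ((H.subgroupOf (Op P G)).equivMapOfInjective _ (Subgroup.subtype_injective _)).trans
        ((MulEquiv.subgroupCongr (by
          rw [Subgroup.subgroupOf_map_subtype, Subgroup.subgroupOf_map_subtype, inf_comm])).trans
        (((Op P G).subgroupOf H).equivMapOfInjective _ (Subgroup.subtype_injective _)).symm)

theorem IsPComponent.map_mk' {G : Type} [Group G] [Finite G] {K : Subgroup G}
    (hK : IsPComponent P K) :
    IsQuasisimpleSubgroup (K.map (QuotientGroup.mk' (Op P G))) := by
  have hOp := Op_eq_subgroupOf hIso hJoinClosed hSubClosed hK.1.toSubgroup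
  have hle : Op P ↥K ≤ (Op P G).comap K.subtype := hOp.le
  have hinj : Function.Injective (QuotientGroup.map (Op P ↥K) (Op P G) K.subtype hle) := by
    rw [injective_iff_map_eq_one]
    intro q
    induction q using QuotientGroup.induction_on with
    | H x =>
      intro hx
      rw [QuotientGroup.map_mk, QuotientGroup.eq_one_iff] at hx
      rw [QuotientGroup.eq_one_iff, hOp]
      exact hx
  have hrange : (QuotientGroup.map (Op P ↥K) (Op P G) K.subtype hle).range =
      K.map (QuotientGroup.mk' (Op P G)) := by
    ext y
    constructor
    · rintro ⟨q, rfl⟩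
      induction q using QuotientGroup.induction_on with
      | H x => exact ⟨x, x.2, rfl⟩
    · rintro ⟨x, hx, rfl⟩
      exact ⟨((⟨x, hx⟩ : ↥K) : ↥K ⧸ Op P ↥K), rfl⟩
  rw [← hrange]
  exact hK.2.1.range hinj

omit hJoinClosed in
/-- A `𝒫`-perfect subgroup of `K N`, with `K` subnormal and `N` a normal `𝒫`-subgroup,
lies in `K`. -/
theorem le_of_le_sup
    (hQuotClosed : ∀ (X : Type) [Group X] [Finite X], P X →
      ∀ (N : Subgroup X) [N.Normal], P (X ⧸ N))
    {G : Type} [Group G] [Finite G] {K L N : Subgroup G} [N.Normal] (hN : P ↥N)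
    (hK : K.IsSubnormal) (hL : Oup P ↥L = ⊤) (hLK : L ≤ K ⊔ N) : L ≤ K := by
  induction hK with
  | top => exact le_top
  | step H K hHK _ hnormal ih =>
    have hLK' : L ≤ K := ih (hLK.trans (sup_le_sup_right hHK N))
    let φ : ↥K →* ↥K ⧸ H.subgroupOf K := QuotientGroup.mk' _
    let ψ : ↥L →* ↥K ⧸ H.subgroupOf K := φ.comp (Subgroup.inclusion hLK')
    have hker : ∀ x : ↥L, ψ x = 1 ↔ (x : G) ∈ H := fun x =>
      (QuotientGroup.eq_one_iff (N := H.subgroupOf K) (Subgroup.inclusion hLK' x)).trans Iff.rfl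
    let θ : ↥(K.subgroupOf N) →* ↥K ⧸ H.subgroupOf K :=
      φ.comp ((N.subtype.comp (K.subgroupOf N).subtype).codRestrict K fun x => x.2)
    have hθ : P ↥θ.range :=
      hIso _ _ ⟨QuotientGroup.quotientKerEquivRange θ⟩
        (hQuotClosed _ (hSubClosed _ hN _) θ.ker)
    have hrange : ψ.range ≤ θ.range := by
      rintro _ ⟨x, rfl⟩
      obtain ⟨k, hk, n, hn, hkn⟩ := Subgroup.mem_sup_of_normal_right.mp (hLK x.2)
      have hnK : n ∈ K := by
        have : n = k⁻¹ * x := by rw [← hkn]; group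
        rw [this]
        exact K.mul_mem (K.inv_mem (hHK hk)) (hLK' x.2)
      refine ⟨⟨⟨n, hn⟩, hnK⟩, ?_⟩
      have hφk : φ ⟨k, hHK hk⟩ = 1 :=
        (QuotientGroup.eq_one_iff (N := H.subgroupOf K) _).mpr hk
      have hx : Subgroup.inclusion hLK' x = ⟨k, hHK hk⟩ * ⟨n, hnK⟩ := Subtype.ext hkn.symm
      change φ ⟨n, hnK⟩ = φ (Subgroup.inclusion hLK' x)
      rw [hx, map_mul, hφk, one_mul]
    have hψ : P ↥ψ.range :=
      hIso _ _ ⟨Subgroup.subgroupOfEquivOfLe hrange⟩ (hSubClosed _ hθ (ψ.range.subgroupOf θ.range))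
    have hquot : QuotIsP P ψ.ker :=
      ⟨inferInstance, hIso _ _ ⟨(QuotientGroup.quotientKerEquivRange ψ).symm⟩ hψ⟩
    have htop : (⊤ : Subgroup ↥L) ≤ ψ.ker := hL ▸ iInf₂_le ψ.ker hquot
    exact fun x hx => (hker ⟨x, hx⟩).mp (htop (Subgroup.mem_top _))

variable
    (hQuotClosed : ∀ (X : Type) [Group X] [Finite X], P X →
      ∀ (N : Subgroup X) [N.Normal], P (X ⧸ N))

include hQuotClosed

/-- A `𝒫`-component is contained in every `𝒫`-component with the same image modulo `O_𝒫(G)`. -/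
theorem IsPComponent.le_of_map_mk'_eq {G : Type} [Group G] [Finite G] {K L : Subgroup G}
    (hK : IsPComponent P K) (hL : IsPComponent P L)
    (h : L.map (QuotientGroup.mk' (Op P G)) = K.map (QuotientGroup.mk' (Op P G))) : L ≤ K := by
  have hsup : L ≤ K ⊔ Op P G := by
    have := Subgroup.map_le_iff_le_comap.mp h.le
    rwa [Subgroup.comap_map_eq, QuotientGroup.ker_mk'] at this
  rcases Op_eq_bot_or hJoinClosed G with h' | h'
  · rwa [h', sup_bot_eq] at hsup
  · exact le_of_le_sup hIso hSubClosed hQuotClosed h' hK.1.toSubgroup hL.2.2 hsup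

/-- A `𝒫`-component contained in the join of a set of `𝒫`-components belongs to that set. -/
theorem IsPComponent.mem_of_le_sSup {G : Type} [Group G] [Finite G] {D : Set (Subgroup G)}
    (hD : ∀ K ∈ D, IsPComponent P K) {L : Subgroup G} (hL : IsPComponent P L)
    (hle : L ≤ sSup D) : L ∈ D := by
  set π := QuotientGroup.mk' (Op P G)
  have hπ : Function.Surjective π := QuotientGroup.mk'_surjective _
  have hLq : IsQuasisimpleSubgroup (L.map π) := hL.map_mk' hIso hJoinClosed hSubClosed
  by_cases hex : ∃ K ∈ D, K.map π = L.map π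
  · obtain ⟨K, hKD, hKL⟩ := hex
    have hK := hD K hKD
    have heq : L = K := le_antisymm
      (hK.le_of_map_mk'_eq hIso hJoinClosed hSubClosed hQuotClosed hL hKL.symm)
      (hL.le_of_map_mk'_eq hIso hJoinClosed hSubClosed hQuotClosed hK hKL)
    rwa [heq]
  · have hcent : sSup D ≤ (Subgroup.centralizer (L.map π : Set (G ⧸ Op P G))).comap π := by
      refine sSup_le fun K hKD => Subgroup.map_le_iff_le_comap.mp ?_
      rw [← Subgroup.commutator_eq_bot_iff_le_centralizer]
      have hK := hD K hKD
      exact ((hK.map_mk' hIso hJoinClosed hSubClosed).eq_or_commutator_eq_bot hLq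
        (hK.1.toSubgroup.map hπ) (hL.1.toSubgroup.map hπ)).resolve_left
        fun heq => hex ⟨K, hKD, heq⟩
    have hself : ⁅L.map π, L.map π⁆ = ⊥ :=
      Subgroup.commutator_eq_bot_iff_le_centralizer.mpr
        (Subgroup.map_le_iff_le_comap.mpr (hle.trans hcent))
    exact (hLq.ne_bot (hLq.perfect.symm.trans hself)).elim

end Radical

theorem statement_7
    (P : (X : Type) → [inst : Group X] → Prop)
    (hIso : ∀ (X Y : Type) [Group X] [Group Y] [Finite X], Nonempty (X ≃* Y) → P X → P Y)
    (hSubClosed : ∀ (X : Type) [Group X] [Finite X], P X → ∀ H : Subgroup X, P ↥H)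
    (hQuotClosed : ∀ (X : Type) [Group X] [Finite X], P X → ∀ (N : Subgroup X) [N.Normal], P (X ⧸ N))
    (hInfClosed : ∀ (X : Type) [Group X] [Finite X] (M N : Subgroup X) [M.Normal] [N.Normal],
      P (X ⧸ M) → P (X ⧸ N) → P (X ⧸ (M ⊓ N)))
    (hJoinClosed : ∀ (X : Type) [Group X] [Finite X] (M N : Subgroup X) [M.Normal] [N.Normal],
      P ↥M → P ↥N → P ↥(M ⊔ N))
    (G : Type) [Group G] [Finite G] (C D : Set (Subgroup G))
    (hC : ∀ K ∈ C, IsPComponent P K) (hD : ∀ K ∈ D, IsPComponent P K)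
    (h : sSup C = sSup D) :
    C = D := by
  apply Set.Subset.antisymm
  · exact fun K hK => (hC K hK).mem_of_le_sSup hIso hJoinClosed hSubClosed hQuotClosed hD
      (h ▸ le_sSup hK)
  · exact fun K hK => (hD K hK).mem_of_le_sSup hIso hJoinClosed hSubClosed hQuotClosed hC
      (h ▸ le_sSup hK)

end PaperPF
end
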